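/- Let γ : ℝ → ℝ³ be a smooth unit-speed curve, let s₀ ∈ ℝ, and let v₀ ∈ ℝ³ satisfy ⟨v₀, γ'(s₀)⟩ = 0. Then there exists a unique smooth normal vector field v along γ that is rotation minimizing and satisfies v(s₀) = v₀. -/

import Mathlib

open scoped RealInnerProductSpace

/-- A curve whose velocity is orthogonal to its position has constant norm. -/
theorem norm_eq_of_inner_deriv_eq_zero {E : Type*} [NormedAddCommGroup E] [InnerProductSpace ℝ E]
    {s : Set ℝ} (hs : IsOpen s) (hs' : IsPreconnected s) {v v' : ℝ → E}
    (hv : ∀ t ∈ s, HasDerivAt v (v' t) t) (horth : ∀ t ∈ s, ⟪v t, v' t⟫ = 0)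
    {a b : ℝ} (ha : a ∈ s) (hb : b ∈ s) : ‖v a‖ = ‖v b‖ := by
  have hd : ∀ t ∈ s, HasDerivAt (fun t => ‖v t‖ ^ 2) 0 t := fun t ht => by
    simpa [horth t ht] using (hv t ht).norm_sq
  have h := hs.is_const_of_deriv_eq_zero hs'
    (fun t ht => (hd t ht).differentiableAt.differentiableWithinAt)
    (fun t ht => (hd t ht).deriv) ha hb
  exact (pow_left_inj₀ (norm_nonneg _) (norm_nonneg _) two_ne_zero).1 h

section SkewLinearODE

variable {E : Type*} [NormedAddCommGroup E] [InnerProductSpace ℝ E]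

/-- Solutions of a skew-symmetric linear differential equation are determined by one value. -/
theorem eqOn_of_hasDerivAt_skew {A : ℝ → E →L[ℝ] E} (hskew : ∀ t x, ⟪x, A t x⟫ = 0)
    {s : Set ℝ} (hs : IsOpen s) (hs' : IsPreconnected s) {v w : ℝ → E}
    (hv : ∀ t ∈ s, HasDerivAt v (A t (v t)) t) (hw : ∀ t ∈ s, HasDerivAt w (A t (w t)) t)
    {s₀ : ℝ} (hs₀ : s₀ ∈ s) (h₀ : v s₀ = w s₀) : Set.EqOn v w s := by
  intro t ht
  have h := norm_eq_of_inner_deriv_eq_zero hs hs'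
    (fun r hr => (hv r hr).sub (hw r hr))
    (fun r _ => by simpa using hskew r (v r - w r)) ht hs₀
  simpa [h₀, sub_eq_zero] using h

open Metric Set in
/-- Initial value problems for skew-symmetric linear differential equations have solutions on any
bounded interval. -/
theorem exists_hasDerivAt_skew_on_ball [FiniteDimensional ℝ E] {A : ℝ → E →L[ℝ] E}
    (hA : Continuous A) (hskew : ∀ t x, ⟪x, A t x⟫ = 0) (s₀ : ℝ) (v₀ : E) {T : ℝ} (hT : 0 < T) :
    ∃ v : ℝ → E, v s₀ = v₀ ∧ ∀ t ∈ ball s₀ T, HasDerivAt v (A t (v t)) t := by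
  let χ : ContDiffBump (0 : E) := ⟨‖v₀‖ + 1, ‖v₀‖ + 2, by positivity, by linarith⟩
  have hcomp : HasCompactSupport fun x => χ x • x := χ.hasCompactSupport.smul_right
  have hsmooth : ContDiff ℝ 1 fun x => χ x • x := χ.contDiff.smul contDiff_id
  obtain ⟨C, hC⟩ := hsmooth.lipschitzWith_of_hasCompactSupport hcomp one_ne_zero
  obtain ⟨B, hB⟩ := hcomp.exists_bound_of_continuous hsmooth.continuous
  obtain ⟨M, hM⟩ := (isCompact_Icc (a := s₀ - T) (b := s₀ + T)).exists_bound_of_continuousOn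
    hA.continuousOn
  have hs₀ : s₀ ∈ Icc (s₀ - T) (s₀ + T) := ⟨by linarith, by linarith⟩
  have hM0 : 0 ≤ M := (norm_nonneg _).trans (hM s₀ hs₀)
  have hB0 : 0 ≤ B := (norm_nonneg _).trans (hB 0)
  lift M to NNReal using hM0
  lift B to NNReal using hB0
  lift T to NNReal using hT.le
  have hPL : IsPicardLindelof (fun t x => A t (χ x • x)) (⟨s₀, hs₀⟩ : Icc _ _) v₀
      (M * B * T) 0 (M * B) (M * C) := by
    refine ⟨fun t ht => ?_, fun x _ => by fun_prop, fun t ht x _ => ?_, by simp⟩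
    · exact (((A t).lipschitz.weaken (show ‖A t‖₊ ≤ M from hM t ht)).comp hC).lipschitzOnWith
    · exact (A t).le_of_opNorm_le_of_le (hM t ht) (hB x)
  obtain ⟨v, hv₀, hv⟩ := hPL.exists_eq_forall_mem_Icc_hasDerivWithinAt₀
  have hv' : ∀ t ∈ ball s₀ (T : ℝ), HasDerivAt v (A t (χ (v t) • v t)) t := fun t ht => by
    rw [Real.ball_eq_Ioo] at ht
    exact (hv t (Ioo_subset_Icc_self ht)).hasDerivAt (Icc_mem_nhds ht.1 ht.2)
  refine ⟨v, hv₀, fun t ht => ?_⟩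
  have hnorm : ‖v t‖ = ‖v s₀‖ := norm_eq_of_inner_deriv_eq_zero isOpen_ball
    (convex_ball s₀ (T : ℝ)).isPreconnected hv'
    (fun r _ => by rw [map_smul, inner_smul_right, hskew, mul_zero]) ht (mem_ball_self hT)
  have hχ : χ (v t) = 1 := χ.one_of_mem_closedBall (by
    rw [mem_closedBall_zero_iff, hnorm]
    change ‖v s₀‖ ≤ ‖v₀‖ + 1
    rw [show v s₀ = v₀ from hv₀]
    linarith)
  simpa [hχ] using hv' t ht

open Metric Set in
/-- Initial value problems for skew-symmetric linear differential equations have global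
solutions. -/
theorem exists_hasDerivAt_skew [FiniteDimensional ℝ E] {A : ℝ → E →L[ℝ] E}
    (hA : Continuous A) (hskew : ∀ t x, ⟪x, A t x⟫ = 0) (s₀ : ℝ) (v₀ : E) :
    ∃ v : ℝ → E, v s₀ = v₀ ∧ ∀ t, HasDerivAt v (A t (v t)) t := by
  choose α hα₀ hα using fun n : ℕ =>
    exists_hasDerivAt_skew_on_ball hA hskew s₀ v₀ (T := n + 1) (by positivity)
  have hagree : ∀ m n : ℕ, m ≤ n → EqOn (α m) (α n) (ball s₀ (m + 1)) := fun m n hmn =>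
    eqOn_of_hasDerivAt_skew hskew isOpen_ball (convex_ball s₀ _).isPreconnected (hα m)
      (fun t ht => hα n t (ball_subset_ball (by gcongr) ht))
      (mem_ball_self (by positivity)) ((hα₀ m).trans (hα₀ n).symm)
  have hmem : ∀ t, t ∈ ball s₀ ((⌊dist t s₀⌋₊ : ℝ) + 1) := fun t =>
    mem_ball.2 (Nat.lt_floor_add_one _)
  have hglue : ∀ n : ℕ, EqOn (fun t => α ⌊dist t s₀⌋₊ t) (α n) (ball s₀ (n + 1)) := by
    intro n t ht
    rcases le_total ⌊dist t s₀⌋₊ n with h | h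
    · exact hagree _ _ h (hmem t)
    · exact (hagree _ _ h ht).symm
  refine ⟨fun t => α ⌊dist t s₀⌋₊ t, hα₀ _, fun t => ?_⟩
  exact (hα _ t (hmem t)).congr_of_eventuallyEq
    ((hglue _).eventuallyEq_of_mem (isOpen_ball.mem_nhds (hmem t)))

end SkewLinearODE

/-- Solutions of a linear differential equation with smooth coefficients are smooth. -/
theorem contDiff_of_hasDerivAt_linear {E : Type*} [NormedAddCommGroup E] [NormedSpace ℝ E]
    {A : ℝ → E →L[ℝ] E} (hA : ContDiff ℝ (⊤ : ℕ∞) A) {v : ℝ → E}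
    (hv : ∀ t, HasDerivAt v (A t (v t)) t) : ContDiff ℝ (⊤ : ℕ∞) v := by
  refine contDiff_infty.2 fun n => ?_
  have hdiff : Differentiable ℝ v := fun t => (hv t).differentiableAt
  induction n with
  | zero => exact contDiff_zero.2 hdiff.continuous
  | succ n ih =>
    push_cast
    refine contDiff_succ_iff_deriv.2 ⟨hdiff, by simp, ?_⟩
    rw [show deriv v = fun t => A t (v t) from funext fun t => (hv t).deriv]
    exact (contDiff_infty.1 hA n).clm_apply ih

theorem rm_exists_unique
    (γ : ℝ → EuclideanSpace ℝ (Fin 3))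
    (hγ : ContDiff ℝ (⊤ : ℕ∞) γ) (hunit : ∀ s, ‖deriv γ s‖ = 1)
    (s₀ : ℝ) (v₀ : EuclideanSpace ℝ (Fin 3)) (hv₀ : ⟪v₀, deriv γ s₀⟫ = 0) :
    ∃! v : ℝ → EuclideanSpace ℝ (Fin 3),
      ContDiff ℝ (⊤ : ℕ∞) v ∧ v s₀ = v₀ ∧ (∀ s, ⟪v s, deriv γ s⟫ = 0) ∧
        (∀ s, ∃ l : ℝ, deriv v s = l • deriv γ s) := by
  set T := deriv γ
  have hT : ContDiff ℝ (⊤ : ℕ∞) T := (contDiff_infty_iff_deriv.1 hγ).2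
  have hT' : ContDiff ℝ (⊤ : ℕ∞) (deriv T) := (contDiff_infty_iff_deriv.1 hT).2
  have hTd : ∀ s, HasDerivAt T (deriv T s) s :=
    fun s => (contDiff_infty_iff_deriv.1 hT).1.differentiableAt.hasDerivAt
  have hTT' : ∀ s, ⟪T s, deriv T s⟫ = 0 := fun s => by
    have h := (hTd s).norm_sq
    simp only [hunit] at h
    simpa using h.unique (hasDerivAt_const s _)
  -- Parallel transport of the whole frame along the curve: a skew-symmetric linear equation.
  let A : ℝ → EuclideanSpace ℝ (Fin 3) →L[ℝ] EuclideanSpace ℝ (Fin 3) := fun s =>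
    (innerSL ℝ (T s)).smulRight (deriv T s) - (innerSL ℝ (deriv T s)).smulRight (T s)
  have hAapp : ∀ s x, A s x = ⟪T s, x⟫ • deriv T s - ⟪deriv T s, x⟫ • T s := fun s x => by
    simp [A]
  have hA : ContDiff ℝ (⊤ : ℕ∞) A :=
    (((innerSL ℝ).contDiff.comp hT).smulRight hT').sub
      (((innerSL ℝ).contDiff.comp hT').smulRight hT)
  have hskew : ∀ s x, ⟪x, A s x⟫ = 0 := fun s x => by
    rw [hAapp, inner_sub_right, inner_smul_right, inner_smul_right, real_inner_comm x,
      real_inner_comm x]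
    ring
  obtain ⟨v, hvs₀, hv⟩ := exists_hasDerivAt_skew hA.continuous hskew s₀ v₀
  have hnormal : ∀ s, ⟪v s, T s⟫ = 0 := by
    have hd : ∀ s, HasDerivAt (fun s => ⟪v s, T s⟫) 0 s := fun s => by
      refine ((hv s).inner ℝ (hTd s)).congr_deriv ?_
      rw [hAapp, inner_sub_left, real_inner_smul_left, real_inner_smul_left,
        real_inner_comm (T s) (deriv T s), hTT', real_inner_self_eq_norm_sq, hunit,
        real_inner_comm (v s) (deriv T s)]
      ring
    intro s
    have h := is_const_of_deriv_eq_zero (fun s => (hd s).differentiableAt)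
      (fun s => (hd s).deriv) s s₀
    simpa only [hvs₀, hv₀] using h
  refine ⟨v, ⟨contDiff_of_hasDerivAt_linear hA hv, hvs₀, hnormal, fun s =>
    ⟨-⟪deriv T s, v s⟫, ?_⟩⟩, ?_⟩
  · rw [(hv s).deriv, hAapp, real_inner_comm (v s) (T s), hnormal]
    simp
  · rintro w ⟨hw, hws₀, hwT, hwd⟩
    funext s
    have hsub : ∀ r, HasDerivAt (w - v) (deriv w r - A r (v r)) r := fun r =>
      ((contDiff_infty_iff_deriv.1 hw).1.differentiableAt.hasDerivAt).sub (hv r)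
    have h := norm_eq_of_inner_deriv_eq_zero isOpen_univ isPreconnected_univ
      (fun r _ => hsub r) (fun r _ => by
        obtain ⟨l, hl⟩ := hwd r
        simp [hl, hAapp, inner_sub_left, inner_add_right, inner_smul_right, hwT, hnormal,
          real_inner_comm (v r) (T r)])
      (Set.mem_univ s) (Set.mem_univ s₀)
    simpa [hws₀, hvs₀, sub_eq_zero] using h
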